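/- Let f : ℕ → ℝ be any function with f(n) → ∞. For every sequence of injective maps x_n : Fin n → ℝ and every sequence of deterministic times t_n with 0 ≤ t_n ≤ N, in the random graph process the probability that G_{t_n} has at least f(n) indices of degree exactly 1 and the whole set Fin n is reconstructible from G_{t_n} tends to 0 as n → ∞. -/

import Mathlib

def Reconstructible {n : ℕ} (x : Fin n → ℝ) (P : Set (Sym2 (Fin n))) (U : Set (Fin n)) : Prop :=
  ∀ w : Fin n → ℝ, Function.Injective w →
    (∀ i j : Fin n, s(i, j) ∈ P → |w i - w j| = |x i - x j|) →
    ∀ i ∈ U, ∀ j ∈ U, |w i - w j| = |x i - x j|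

instance (n : ℕ) : Nonempty (Fin (n.choose 2) ≃ {e : Sym2 (Fin n) // ¬ e.IsDiag}) := by
  have h : Fintype.card {e : Sym2 (Fin n) // ¬ e.IsDiag} = n.choose 2 := by
    simpa using Sym2.card_subtype_not_diag (α := Fin n)
  exact ⟨(Fintype.equivFinOfCardEq h).symm⟩

instance (n : ℕ) : MeasurableSpace (Fin (n.choose 2) ≃ {e : Sym2 (Fin n) // ¬ e.IsDiag}) := ⊤

/-- The uniform measure on orderings of the `N = n.choose 2` unordered pairs of distinct
indices of `Fin n`, modelling the random graph process. -/
noncomputable def processMeasure (n : ℕ) :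
    MeasureTheory.Measure (Fin (n.choose 2) ≃ {e : Sym2 (Fin n) // ¬ e.IsDiag}) :=
  (PMF.uniformOfFintype _).toMeasure

/-- `Gt σ t` is the set of the first `t` revealed pairs in the ordering `σ`. -/
def Gt {n : ℕ} (σ : Fin (n.choose 2) ≃ {e : Sym2 (Fin n) // ¬ e.IsDiag}) (t : ℕ) :
    Set (Sym2 (Fin n)) :=
  {e | ∃ s : Fin (n.choose 2), (s : ℕ) < t ∧ (σ s : Sym2 (Fin n)) = e}

/-- The degree of an index `u`: the number of revealed pairs containing `u`. -/
noncomputable def degree {n : ℕ} (G : Set (Sym2 (Fin n))) (u : Fin n) : ℕ :=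
  {e ∈ G | u ∈ e}.ncard

theorem avg {n m : ℕ} (h : (Fin m ↪ Fin n) → ℝ) (q : Fin m ↪ Fin n) :
    (∑ π : Equiv.Perm (Fin n), h (q.trans π.toEmbedding)) * (n.descFactorial m : ℝ)
      = (n.factorial : ℝ) * ∑ p, h p := by
  have key : ∀ p : Fin m ↪ Fin n, ∑ π : Equiv.Perm (Fin n), h (p.trans π.toEmbedding)
      = ∑ π : Equiv.Perm (Fin n), h (q.trans π.toEmbedding) := by
    intro p
    obtain ⟨τ, hτ⟩ : ∃ τ : Equiv.Perm (Fin n), q.trans τ.toEmbedding = p := by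
      have := Equiv.Perm.isMultiplyPretransitive (Fin n) m
      obtain ⟨τ, h⟩ := MulAction.exists_smul_eq (Equiv.Perm (Fin n)) q p
      exact ⟨τ, by rw [← h]; ext; simp [Function.Embedding.smul_apply]⟩
    refine Fintype.sum_equiv (Equiv.mulRight τ) _ _ fun π => ?_
    congr 1
    rw [← hτ]
    ext; simp
  have h1 : ∑ p : Fin m ↪ Fin n, ∑ π : Equiv.Perm (Fin n), h (p.trans π.toEmbedding)
      = (n.descFactorial m : ℝ) * ∑ π : Equiv.Perm (Fin n), h (q.trans π.toEmbedding) := by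
    rw [Finset.sum_congr rfl fun p _ => key p]
    simp [Fintype.card_embedding_eq]
  have h2 : ∀ π : Equiv.Perm (Fin n), ∑ p : Fin m ↪ Fin n, h (p.trans π.toEmbedding)
      = ∑ p, h p := by
    intro π
    refine Fintype.sum_equiv (Equiv.embeddingCongr (Equiv.refl _) π) _ _ fun p => ?_
    congr 1
  rw [mul_comm, ← h1, Finset.sum_comm, Finset.sum_congr rfl fun p _ => h2 p]
  simp [Fintype.card_perm]

theorem sum_le_inj {α β : Type*} [Fintype α] [Fintype β] (φ : α → β)
    (hφ : Function.Injective φ) (F : β → ℝ) (hF : ∀ b, 0 ≤ F b) :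
    ∑ a, F (φ a) ≤ ∑ b, F b := by
  classical
  rw [← Finset.sum_image (f := F) (s := Finset.univ) (g := φ) (fun a _ b _ h => hφ h)]
  exact Finset.sum_le_univ_sum_of_nonneg hF

theorem avg2 {n : ℕ} (g : Fin n → Fin n → ℝ) (hd : ∀ a, g a a = 0) (u v : Fin n) (huv : u ≠ v) :
    (∑ π : Equiv.Perm (Fin n), g (π u) (π v)) * ((n:ℝ) * (n - 1))
      = (n.factorial : ℝ) * ∑ b, ∑ a, g a b := by
  classical
  let q : Fin 2 ↪ Fin n := ⟨![u, v], by
    intro i j; fin_cases i <;> fin_cases j <;> simp [huv, huv.symm]⟩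
  have h := avg (fun q => g (q 0) (q 1)) q
  have hn : 1 ≤ n := by have := u.2; omega
  have e : ((n.descFactorial 2 : ℕ) : ℝ) = (n:ℝ) * (n - 1) := by
    simp [Nat.descFactorial, Nat.cast_sub hn]; ring
  rw [e] at h
  simp only [Function.Embedding.trans_apply, Equiv.coe_toEmbedding, q] at h
  change (∑ π : Equiv.Perm (Fin n), g (π u) (π v)) * _ = _ at h
  rw [h]
  congr 1
  rw [← Fintype.sum_prod_type' (f := fun b a => g a b)]
  refine Finset.sum_of_injOn (fun q => (q 1, q 0)) ?_ (by simp) ?_ (by simp)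
  · intro p _ p' _ hh
    simp at hh
    ext i; fin_cases i <;> simp [hh]
  · rintro ⟨b, a⟩ _ hb
    by_cases hab : a = b
    · simp [hab, hd]
    · exfalso; apply hb
      refine ⟨⟨![a, b], by
        intro i j; fin_cases i <;> fin_cases j <;> simp [hab, Ne.symm hab]⟩, by simp, rfl⟩

theorem avg3 {n : ℕ} (g : Fin n → Fin n → ℝ) (hg : ∀ a b, 0 ≤ g a b) (u u' v : Fin n)
    (huv : u ≠ v) (h_uv3 : u' ≠ v) (huu : u ≠ u') :
    (∑ π : Equiv.Perm (Fin n), g (π u) (π v) * g (π u') (π v)) * ((n:ℝ) * (n - 1) * (n - 2))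
      ≤ (n.factorial : ℝ) * ∑ b, (∑ a, g a b) * ∑ a, g a b := by
  classical
  let q : Fin 3 ↪ Fin n := ⟨![u, u', v], by
    intro i j; fin_cases i <;> fin_cases j <;> simp [huv, huv.symm, h_uv3, h_uv3.symm, huu, huu.symm]⟩
  have h := avg (fun q => g (q 0) (q 2) * g (q 1) (q 2)) q
  have hn : 3 ≤ n := by simpa using Fintype.card_le_of_embedding q
  have e : ((n.descFactorial 3 : ℕ) : ℝ) = (n:ℝ) * (n - 1) * (n - 2) := by
    simp [Nat.descFactorial, Nat.cast_sub (show 1 ≤ n by omega), Nat.cast_sub (show 2 ≤ n by omega)]; ring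
  rw [e] at h
  simp only [Function.Embedding.trans_apply, Equiv.coe_toEmbedding, q] at h
  change (∑ π : Equiv.Perm (Fin n), g (π u) (π v) * g (π u') (π v)) * _ = _ at h
  rw [h]
  gcongr
  simp only [Finset.sum_mul_sum]
  rw [← Fintype.sum_prod_type' (f := fun b a => ∑ a', g a b * g a' b)]
  rw [← Fintype.sum_prod_type' (f := fun (p : Fin n × Fin n) a' => g p.2 p.1 * g a' p.1)]
  refine sum_le_inj (fun q : Fin 3 ↪ Fin n => ((q 2, q 0), q 1)) ?_
    (fun p => g p.1.2 p.1.1 * g p.2 p.1.1) (fun p => mul_nonneg (hg _ _) (hg _ _))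
  intro p p' hh
  simp at hh
  ext i; fin_cases i <;> simp [hh]

theorem avg4 {n : ℕ} (g : Fin n → Fin n → ℝ) (hg : ∀ a b, 0 ≤ g a b) (u v u' v' : Fin n)
    (huv : u ≠ v) (h_uv3 : u' ≠ v) (huu : u ≠ u') (hvv : v ≠ v') (huv' : u ≠ v') (h_uv4 : u' ≠ v') :
    (∑ π : Equiv.Perm (Fin n), g (π u) (π v) * g (π u') (π v'))
      * ((n:ℝ) * (n - 1) * (n - 2) * (n - 3))
      ≤ (n.factorial : ℝ) * ((∑ b, ∑ a, g a b) * ∑ b, ∑ a, g a b) := by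
  classical
  let q : Fin 4 ↪ Fin n := ⟨![u, v, u', v'], by
    intro i j; fin_cases i <;> fin_cases j <;> simp [huv, huv.symm, h_uv3, h_uv3.symm, huu, huu.symm,
      hvv, hvv.symm, huv', huv'.symm, h_uv4, h_uv4.symm]⟩
  have h := avg (fun q => g (q 0) (q 1) * g (q 2) (q 3)) q
  have hn : 4 ≤ n := by simpa using Fintype.card_le_of_embedding q
  have e : ((n.descFactorial 4 : ℕ) : ℝ) = (n:ℝ) * (n - 1) * (n - 2) * (n - 3) := by
    simp [Nat.descFactorial, Nat.cast_sub (show 1 ≤ n by omega),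
      Nat.cast_sub (show 2 ≤ n by omega), Nat.cast_sub (show 3 ≤ n by omega)]; ring
  rw [e] at h
  simp only [Function.Embedding.trans_apply, Equiv.coe_toEmbedding, q] at h
  change (∑ π : Equiv.Perm (Fin n), g (π u) (π v) * g (π u') (π v')) * _ = _ at h
  rw [h]
  gcongr
  rw [← Fintype.sum_prod_type' (f := fun b a => g a b), Fintype.sum_mul_sum]
  rw [← Fintype.sum_prod_type' (f := fun (p p' : Fin n × Fin n) => g p.2 p.1 * g p'.2 p'.1)]
  refine sum_le_inj (fun q : Fin 4 ↪ Fin n => ((q 1, q 0), (q 3, q 2))) ?_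
    (fun p => g p.1.2 p.1.1 * g p.2.2 p.2.1) (fun p => mul_nonneg (hg _ _) (hg _ _))
  intro p p' hh
  simp at hh
  ext i; fin_cases i <;> simp [hh]

/-- `u` can be reflected across `v` without landing on another point. -/
def FreePair {n : ℕ} (x : Fin n → ℝ) (a b : Fin n) : Prop :=
  a ≠ b ∧ ∀ r, x r ≠ 2 * x b - x a

theorem not_free_of_rec {n : ℕ} (hn : 3 ≤ n) (x : Fin n → ℝ) (hx : Function.Injective x)
    (P : Set (Sym2 (Fin n))) (hP : Reconstructible x P Set.univ) (u v : Fin n)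
    (hu : ∀ e ∈ P, u ∈ e → e = s(u, v)) : ¬ FreePair x u v := by
  classical
  rintro ⟨huv, hfree⟩
  have hxuv : x u ≠ x v := fun h => huv (hx h)
  obtain ⟨i, hi⟩ : ∃ i : Fin n, i ∉ ({u, v} : Finset (Fin n)) := by
    by_contra hcon
    push Not at hcon
    have h1 : (Finset.univ : Finset (Fin n)) ⊆ {u, v} := fun i _ => hcon i
    have h2 := Finset.card_le_card h1
    have h3 := Finset.card_le_two (a := u) (b := v)
    simp at h2
    omega
  simp only [Finset.mem_insert, Finset.mem_singleton, not_or] at hi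
  obtain ⟨hiu, hiv⟩ := hi
  have hxiv : x i ≠ x v := fun h => hiv (hx h)
  let w := Function.update x u (2 * x v - x u)
  have wu : w u = 2 * x v - x u := by simp [w]
  have wo : ∀ j, j ≠ u → w j = x j := fun j hj => by simp [w, hj]
  have key := hP w ?_ ?_ u trivial i trivial
  · rw [wu, wo i hiu] at key
    rcases abs_eq_abs.1 key with h | h
    · apply hxuv; linarith
    · apply hxiv; linarith
  · intro a b hab
    by_cases ha : a = u <;> by_cases hb : b = u
    · rw [ha, hb]
    · rw [ha, wu, wo b hb] at hab
      exact absurd hab.symm (hfree b)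
    · rw [hb, wu, wo a ha] at hab
      exact absurd hab (hfree a)
    · rw [wo a ha, wo b hb] at hab
      exact hx hab
  · have main : ∀ j, s(u, j) ∈ P → |w u - w j| = |x u - x j| := by
      intro j hj
      have h := hu _ hj (by simp)
      have hjv : j = v := by
        rw [Sym2.eq_iff] at h
        rcases h with h | h
        · exact h.2
        · exact absurd h.1 huv
      subst hjv
      rw [wu, wo j (Ne.symm huv), show 2 * x j - x u - x j = -(x u - x j) by ring, abs_neg]
    intro i j hij
    by_cases hi : i = u
    · subst hi; exact main j hij
    by_cases hj : j = u
    · subst hj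
      rw [abs_sub_comm, abs_sub_comm (x i)]
      exact main i (by rwa [Sym2.eq_swap])
    rw [wo i hi, wo j hj]

theorem free_count {n : ℕ} (x : Fin n → ℝ) (hx : Function.Injective x) (d : ℕ) (hd : d ≤ n) :
    ∃ (M : Finset (Fin n)) (A : Fin n → Finset (Fin n)), M.card ≤ d ∧
      (∀ b ∈ M, A b = ∅) ∧ (∀ b ∉ M, (A b).card = d) ∧ ∀ b, ∀ a ∈ A b, FreePair x a b := by
  classical
  let Lf : Fin n → Finset (Fin n) := fun b => Finset.univ.filter fun a => x a < x b
  let Rt : Fin n → Finset (Fin n) := fun b => Finset.univ.filter fun a => x b < x a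
  have hLR : ∀ b, (Lf b).card + (Rt b).card + 1 = n := by
    intro b
    have h1 : Disjoint (Lf b) (Rt b) := by
      rw [Finset.disjoint_left]; intro a; simp [Lf, Rt]; intro h; exact h.le
    have h2 : Lf b ∪ Rt b = Finset.univ.erase b := by
      ext a
      simp only [Lf, Rt, Finset.mem_union, Finset.mem_filter, Finset.mem_univ, true_and,
        Finset.mem_erase, and_true]
      rw [← ne_iff_lt_or_gt]
      exact hx.ne_iff
    rw [← Finset.card_union_of_disjoint h1, h2, Finset.card_erase_of_mem (Finset.mem_univ _)]
    have := b.2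
    simp; omega
  let Fr : Fin n → Finset (Fin n) := fun b => Finset.univ.filter fun a => FreePair x a b
  -- mirrored points inject
  have inj : ∀ b (S T : Finset (Fin n)), b ∉ S → (∀ a ∈ S, ∀ r, x r = 2 * x b - x a → r ∈ T) →
      S.card ≤ T.card + (Fr b).card := by
    intro b S T hb hST
    have h1 : (S \ Fr b).card ≤ T.card := by
      have hex : ∀ a ∈ S \ Fr b, ∃ r, x r = 2 * x b - x a := by
        intro a ha
        obtain ⟨ha1, ha2⟩ := Finset.mem_sdiff.1 ha
        simp only [Fr, Finset.mem_filter, Finset.mem_univ, true_and] at ha2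
        by_contra hcon
        push Not at hcon
        exact ha2 ⟨fun h => hb (h ▸ ha1), hcon⟩
      choose! r hr using hex
      refine Finset.card_le_card_of_injOn r (fun a ha => ?_) (fun a ha a' ha' h => ?_)
      · exact hST a (Finset.mem_sdiff.1 ha).1 _ (hr a ha)
      · have e1 := hr a ha
        have e2 := hr a' ha'
        rw [h] at e1
        apply hx; linarith
    have h2 := Finset.card_le_card_sdiff_add_card (t := Fr b) (s := S)
    omega
  have hL : ∀ b, (Lf b).card ≤ (Rt b).card + (Fr b).card := by
    intro b
    refine inj b _ _ (by simp [Lf]) ?_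
    intro a ha r hr
    simp [Lf, Rt] at ha ⊢; linarith
  have hR : ∀ b, (Rt b).card ≤ (Lf b).card + (Fr b).card := by
    intro b
    refine inj b _ _ (by simp [Rt]) ?_
    intro a ha r hr
    simp [Lf, Rt] at ha ⊢; linarith
  let M : Finset (Fin n) := Finset.univ.filter fun b => (Fr b).card < d
  have hex : ∀ b, ∃ A : Finset (Fin n), A ⊆ Fr b ∧ (b ∈ M → A = ∅) ∧ (b ∉ M → A.card = d) := by
    intro b
    by_cases hb : b ∈ M
    · exact ⟨∅, by simp, by simp, by simp [hb]⟩
    · have : d ≤ (Fr b).card := by simpa [M] using hb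
      obtain ⟨A, h1, h2⟩ := Finset.exists_subset_card_eq this
      exact ⟨A, h1, fun h => absurd h hb, fun _ => h2⟩
  choose A hA using hex
  refine ⟨M, A, ?_, fun b => (hA b).2.1, fun b => (hA b).2.2, fun b a ha => ?_⟩
  · have hcard : (Finset.Ico ((n - d + 1) / 2) ((n + d) / 2)).card ≤ d := by
      simp; omega
    refine le_trans (Finset.card_le_card_of_injOn (fun b => (Lf b).card) ?_ ?_) hcard
    · intro b hb
      have h0 : (Fr b).card < d := by simpa [M] using hb
      have h1 := hLR b
      have h2 := hL b
      have h3 := hR b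
      simp only [Finset.coe_Ico, Set.mem_Ico]
      omega
    · have lt : ∀ a b, x a < x b → (Lf a).card < (Lf b).card := by
        intro a b hab
        apply Finset.card_lt_card
        rw [Finset.ssubset_iff_of_subset]
        · exact ⟨a, by simp [Lf, hab], by simp [Lf]⟩
        · intro c hc
          simp [Lf] at hc ⊢; linarith
      intro a _ b _ h
      by_contra hne
      rcases lt_or_gt_of_ne (hx.ne hne) with h' | h'
      · exact (lt a b h').ne h
      · exact (lt b a h').ne h.symm
  · simpa [Fr] using (hA b).1 ha

theorem second_moment {n : ℕ} (hn : 4 ≤ n) (d : ℕ) (hd0 : 0 < d) (hdn : d ≤ n)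
    (M : Finset (Fin n)) (A : Fin n → Finset (Fin n)) (hM : M.card ≤ d)
    (hA0 : ∀ b ∈ M, A b = ∅) (hA1 : ∀ b ∉ M, (A b).card = d) (hAne : ∀ b, b ∉ A b)
    (L : Finset (Fin n)) (hL : 0 < L.card) (N : Fin n → Fin n) (hN : ∀ u ∈ L, N u ≠ u)
    (hNN : ∀ u ∈ L, ∀ u' ∈ L, N u' = u → u' = N u) :
    ((Finset.univ.filter fun π : Equiv.Perm (Fin n) => ∀ u ∈ L, π u ∉ A (π (N u))).card : ℝ)
      ≤ (n.factorial : ℝ) * (2 * n ^ 2 / ((n - 1) * d * L.card)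
        + n ^ 3 / ((n - 1) * (n - 2) * (n - 3)) - 2 * (n - d) / (n - 1) + 1) := by
  classical
  have hn4 : (4 : ℝ) ≤ n := by exact_mod_cast hn
  have hdpos : (0 : ℝ) < d := by exact_mod_cast hd0
  have hdn' : (d : ℝ) ≤ n := by exact_mod_cast hdn
  have hKpos : (0 : ℝ) < L.card := by exact_mod_cast hL
  have p1 : (0 : ℝ) < n - 1 := by linarith
  have p2 : (0 : ℝ) < n - 2 := by linarith
  have p3 : (0 : ℝ) < n - 3 := by linarith
  have p0 : (0 : ℝ) < n := by linarith
  have pf : (0 : ℝ) < n.factorial := by exact_mod_cast n.factorial_pos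
  set K : ℝ := (L.card : ℝ) with hK
  let g : Fin n → Fin n → ℝ := fun a b => if a ∈ A b then 1 else 0
  have hg0 : ∀ a b, 0 ≤ g a b := fun a b => by simp only [g]; split_ifs <;> norm_num
  have hg1 : ∀ a b, g a b ≤ 1 := fun a b => by simp only [g]; split_ifs <;> norm_num
  have hgd : ∀ a, g a a = 0 := fun a => by simp [g, hAne a]
  have hsum : ∀ b, ∑ a, g a b = ((A b).card : ℝ) := fun b => by simp [g]
  have hAd : ∀ b, ((A b).card : ℝ) ≤ d := by
    intro b
    by_cases hb : b ∈ M
    · simp [hA0 b hb]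
    · rw [hA1 b hb]
  have hAc0 : ∀ b, (0 : ℝ) ≤ ((A b).card : ℝ) := fun b => by positivity
  have hup : ∑ b, ∑ a, g a b ≤ n * d := by
    calc ∑ b, ∑ a, g a b ≤ ∑ b : Fin n, (d : ℝ) := Finset.sum_le_sum fun b _ => by
          rw [hsum]; exact hAd b
      _ = n * d := by simp
  have hup0 : 0 ≤ ∑ b, ∑ a, g a b :=
    Finset.sum_nonneg fun b _ => Finset.sum_nonneg fun a _ => hg0 a b
  have hlow : ((n : ℝ) - d) * d ≤ ∑ b, ∑ a, g a b := by
    have h1 : ∑ b ∈ Finset.univ \ M, ∑ a, g a b ≤ ∑ b, ∑ a, g a b :=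
      Finset.sum_le_sum_of_subset_of_nonneg (Finset.sdiff_subset) fun b _ _ =>
        Finset.sum_nonneg fun a _ => hg0 a b
    have h2 : ∑ b ∈ Finset.univ \ M, ∑ a, g a b = ((Finset.univ \ M).card : ℝ) * d := by
      rw [Finset.sum_congr rfl (g := fun _ => (d : ℝ))]
      · simp
      · intro b hb
        rw [hsum, hA1 b (by simpa using hb)]
    have h3 : (n : ℝ) - d ≤ ((Finset.univ \ M).card : ℝ) := by
      have := Finset.card_sdiff_add_card_eq_card (Finset.subset_univ M)
      simp only [Finset.card_univ, Fintype.card_fin] at this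
      have : n ≤ (Finset.univ \ M).card + d := by omega
      have : (n : ℝ) ≤ (Finset.univ \ M).card + d := by exact_mod_cast this
      linarith
    calc ((n : ℝ) - d) * d ≤ ((Finset.univ \ M).card : ℝ) * d := by gcongr
      _ ≤ _ := by rw [← h2]; exact h1
  have hsq : ∑ b, (∑ a, g a b) * ∑ a, g a b ≤ n * (d * d) := by
    calc ∑ b, (∑ a, g a b) * ∑ a, g a b ≤ ∑ b : Fin n, ((d : ℝ) * d) :=
          Finset.sum_le_sum fun b _ => by
            rw [hsum]; exact mul_le_mul (hAd b) (hAd b) (hAc0 b) hdpos.le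
      _ = n * (d * d) := by simp
  let I : Fin n → Equiv.Perm (Fin n) → ℝ := fun u π => g (π u) (π (N u))
  let F : ℝ := n.factorial
  -- first moments
  have m1 : ∀ u ∈ L, F * (((n : ℝ) - d) * d / (n * (n - 1))) ≤ ∑ π, I u π := by
    intro u hu
    have h := avg2 g hgd u (N u) (hN u hu).symm
    rw [← mul_div_assoc, div_le_iff₀ (by positivity)]
    simp only [I]; rw [h]
    exact mul_le_mul_of_nonneg_left hlow pf.le
  have m1' : ∀ u ∈ L, ∑ π, I u π ≤ F * (d / (n - 1)) := by
    intro u hu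
    have h := avg2 g hgd u (N u) (hN u hu).symm
    have h2 : (∑ π, I u π) * (n * (n - 1)) ≤ F * (n * d) := by
      simp only [I]; rw [h]
      exact mul_le_mul_of_nonneg_left hup pf.le
    rw [← mul_div_assoc, le_div_iff₀ p1]
    have : n * ((∑ π, I u π) * (n - 1)) ≤ n * (F * d) := by linarith
    exact le_of_mul_le_mul_left this p0
  let T : ℝ := n * d ^ 2 / ((n - 1) * (n - 2) * (n - 3))
  have hT0 : 0 ≤ T := by positivity
  have m2 : ∀ u ∈ L, ∀ u' ∈ L, u' ≠ u → u' ≠ N u → ∑ π, I u π * I u' π ≤ F * T := by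
    intro u hu u' hu' h1 h2
    have h3 : u ≠ N u' := fun h => h2 (hNN u hu u' hu' h.symm)
    rw [← mul_div_assoc, le_div_iff₀ (by positivity)]
    by_cases hv : N u = N u'
    · have h := avg3 g hg0 u u' (N u) (hN u hu).symm h2 h1.symm
      have hS : (∑ π, I u π * I u' π) * ((n:ℝ) * (n - 1) * (n - 2)) ≤ F * (n * (d * d)) := by
        simp only [I, ← hv]
        exact h.trans (mul_le_mul_of_nonneg_left hsq pf.le)
      have hS' : n * ((∑ π, I u π * I u' π) * ((n - 1) * (n - 2) * (n - 3)))
          ≤ n * (F * (n * d ^ 2)) := by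
        calc n * ((∑ π, I u π * I u' π) * ((n - 1) * (n - 2) * (n - 3)))
            = ((∑ π, I u π * I u' π) * ((n:ℝ) * (n - 1) * (n - 2))) * (n - 3) := by ring
          _ ≤ F * (n * (d * d)) * (n - 3) := by gcongr
          _ ≤ F * (n * (d * d)) * n := by
              apply mul_le_mul_of_nonneg_left (by linarith)
              have : 0 ≤ F := pf.le
              positivity
          _ = n * (F * (n * d ^ 2)) := by ring
      exact le_of_mul_le_mul_left hS' p0
    · have h := avg4 g hg0 u (N u) u' (N u') (hN u hu).symm h2 h1.symm hv h3 (hN u' hu').symm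
      have hS : (∑ π, I u π * I u' π) * ((n:ℝ) * (n - 1) * (n - 2) * (n - 3))
          ≤ F * ((n * d) * (n * d)) := by
        refine h.trans (mul_le_mul_of_nonneg_left ?_ pf.le)
        exact mul_le_mul hup hup hup0 (by positivity)
      have hS' : n * ((∑ π, I u π * I u' π) * ((n - 1) * (n - 2) * (n - 3)))
          ≤ n * (F * (n * d ^ 2)) := by
        calc n * ((∑ π, I u π * I u' π) * ((n - 1) * (n - 2) * (n - 3)))
            = ((∑ π, I u π * I u' π) * ((n:ℝ) * (n - 1) * (n - 2) * (n - 3))) := by ring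
          _ ≤ _ := hS
          _ = n * (F * (n * d ^ 2)) := by ring
      exact le_of_mul_le_mul_left hS' p0
  have hFT : 0 ≤ F * T := mul_nonneg pf.le hT0
  have hFd : 0 ≤ F * (d / (n - 1)) := mul_nonneg pf.le (by positivity)
  have row : ∀ u ∈ L, ∑ u' ∈ L, ∑ π, I u π * I u' π ≤ K * (F * T) + 2 * (F * (d / (n - 1))) := by
    intro u hu
    have hterm : ∀ u' ∈ L, ∑ π, I u π * I u' π ≤
        F * T + ((if u' = u then F * (d / (n - 1)) else 0)
          + (if u' = N u then F * (d / (n - 1)) else 0)) := by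
      intro u' hu'
      have hle : ∑ π, I u π * I u' π ≤ F * (d / (n - 1)) :=
        (Finset.sum_le_sum fun π _ =>
          mul_le_of_le_one_right (hg0 _ _) (hg1 _ _)).trans (m1' u hu)
      by_cases h1 : u' = u
      · rw [if_pos h1]
        split_ifs <;> linarith
      · by_cases h2 : u' = N u
        · rw [if_neg h1, if_pos h2]; linarith
        · rw [if_neg h1, if_neg h2]
          have := m2 u hu u' hu' h1 h2
          linarith
    refine (Finset.sum_le_sum hterm).trans ?_
    rw [Finset.sum_add_distrib, Finset.sum_add_distrib, Finset.sum_const, nsmul_eq_mul,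
      Finset.sum_ite_eq', Finset.sum_ite_eq', two_mul]
    gcongr
    · exact (if_pos hu).le
    · split_ifs
      · exact le_rfl
      · exact hFd
  let Y : Equiv.Perm (Fin n) → ℝ := fun π => ∑ u ∈ L, I u π
  have EY : K * (F * (((n : ℝ) - d) * d / (n * (n - 1)))) ≤ ∑ π, Y π := by
    simp only [Y]
    rw [Finset.sum_comm]
    refine le_trans ?_ (Finset.sum_le_sum m1)
    simp [hK]
  have EY2 : ∑ π, Y π * Y π ≤ K * (K * (F * T) + 2 * (F * (d / (n - 1)))) := by
    have : ∑ π, Y π * Y π = ∑ u ∈ L, ∑ u' ∈ L, ∑ π, I u π * I u' π := by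
      simp only [Y, Finset.sum_mul_sum]
      rw [Finset.sum_comm]
      exact Finset.sum_congr rfl fun u _ => Finset.sum_comm
    rw [this]
    refine (Finset.sum_le_sum row).trans ?_
    rw [Finset.sum_const, nsmul_eq_mul]
  let c : ℝ := K * d / n
  have hc : 0 < c := by positivity
  have cheb : ((Finset.univ.filter fun π : Equiv.Perm (Fin n) =>
      ∀ u ∈ L, π u ∉ A (π (N u))).card : ℝ) * c ^ 2 ≤ ∑ π, (Y π - c) ^ 2 := by
    rw [← nsmul_eq_mul, ← Finset.sum_const]
    refine le_trans (Finset.sum_le_sum (g := fun π => (Y π - c) ^ 2) fun π hπ => ?_)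
      (Finset.sum_le_univ_sum_of_nonneg fun π => sq_nonneg _)
    have hY : Y π = 0 := by
      refine Finset.sum_eq_zero fun u hu => ?_
      simp [I, g, (Finset.mem_filter.1 hπ).2 u hu]
    rw [hY]; simp
  have expand : ∑ π, (Y π - c) ^ 2 = ∑ π, Y π * Y π - 2 * c * ∑ π, Y π + F * c ^ 2 := by
    have : ∀ π, (Y π - c) ^ 2 = Y π * Y π - 2 * c * Y π + c ^ 2 := fun π => by ring
    simp only [this]
    rw [Finset.sum_add_distrib, Finset.sum_sub_distrib, ← Finset.mul_sum]
    simp [F, Fintype.card_perm]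
  have tot : ((Finset.univ.filter fun π : Equiv.Perm (Fin n) =>
      ∀ u ∈ L, π u ∉ A (π (N u))).card : ℝ) * c ^ 2 ≤
      K * (K * (F * T) + 2 * (F * (d / (n - 1))))
        - 2 * c * (K * (F * (((n : ℝ) - d) * d / (n * (n - 1))))) + F * c ^ 2 := by
    refine cheb.trans ?_
    rw [expand]
    have := mul_le_mul_of_nonneg_left EY (show 0 ≤ 2 * c by positivity)
    linarith
  have fin : K * (K * (F * T) + 2 * (F * (d / (n - 1))))
        - 2 * c * (K * (F * (((n : ℝ) - d) * d / (n * (n - 1))))) + F * c ^ 2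
      = (F * (2 * n ^ 2 / ((n - 1) * d * K)
        + n ^ 3 / ((n - 1) * (n - 2) * (n - 3)) - 2 * (n - d) / (n - 1) + 1)) * c ^ 2 := by
    have q1 := p1.ne'
    have q2 := p2.ne'
    have q3 := p3.ne'
    simp only [T, c]
    field_simp
    ring
  rw [fin] at tot
  exact le_of_mul_le_mul_right tot (by positivity)

theorem second_moment' {n q : ℕ} (hn : 8 ≤ n) (hq : 1 ≤ q) (hqn : q ≤ n) (k : ℝ) (hk : 0 < k)
    (M : Finset (Fin n)) (A : Fin n → Finset (Fin n)) (hM : M.card ≤ n / q)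
    (hA0 : ∀ b ∈ M, A b = ∅) (hA1 : ∀ b ∉ M, (A b).card = n / q) (hAne : ∀ b, b ∉ A b)
    (L : Finset (Fin n)) (hL : k ≤ L.card) (N : Fin n → Fin n) (hN : ∀ u ∈ L, N u ≠ u)
    (hNN : ∀ u ∈ L, ∀ u' ∈ L, N u' = u → u' = N u) :
    ((Finset.univ.filter fun π : Equiv.Perm (Fin n) => ∀ u ∈ L, π u ∉ A (π (N u))).card : ℝ)
      ≤ (n.factorial : ℝ) * (8 * q / k + 24 / n + 2 / q) := by
  have hKpos : (0 : ℝ) < L.card := lt_of_lt_of_le hk hL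
  have hd0 : 0 < n / q := Nat.div_pos hqn hq
  have h := second_moment (by omega) (n / q) hd0 (Nat.div_le_self _ _) M A hM hA0 hA1 hAne L
    (by exact_mod_cast hKpos) N hN hNN
  refine h.trans (mul_le_mul_of_nonneg_left ?_ (by positivity))
  have hnr : (8 : ℝ) ≤ n := by exact_mod_cast hn
  have hqr : (1 : ℝ) ≤ q := by exact_mod_cast hq
  set d := n / q
  have hdpos : (0 : ℝ) < d := by exact_mod_cast hd0
  have hd1 : (d : ℝ) * q ≤ n := by exact_mod_cast Nat.div_mul_le_self n q
  have hd2 : (n : ℝ) ≤ 2 * q * d := by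
    have h1 : n < q * (d + 1) := Nat.lt_mul_div_succ n hq
    have h2 : n ≤ 2 * q * d := by nlinarith
    exact_mod_cast h2
  have hdn : (d : ℝ) ≤ n := by nlinarith
  have p1 : (0 : ℝ) < n - 1 := by linarith
  have p2 : (0 : ℝ) < n - 2 := by linarith
  have p3 : (0 : ℝ) < n - 3 := by linarith
  have a1 : 2 * (n : ℝ) ^ 2 / ((n - 1) * d * L.card) ≤ 8 * q / k := by
    rw [div_le_div_iff₀ (by positivity) hk]
    have e1 : (n : ℝ) ≤ 2 * (n - 1) := by linarith
    have e2 : (n : ℝ) * n ≤ (2 * (n - 1)) * (2 * q * d) := by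
      apply mul_le_mul e1 hd2 <;> linarith
    have e3 : ((n : ℝ) * n) * k ≤ ((2 * (n - 1)) * (2 * q * d)) * L.card := by
      apply mul_le_mul e2 hL hk.le; positivity
    nlinarith
  have a2 : (n : ℝ) ^ 3 / ((n - 1) * (n - 2) * (n - 3)) ≤ 1 + 24 / n := by
    have : (1 : ℝ) + 24 / n = (n + 24) / n := by field_simp
    rw [this, div_le_div_iff₀ (by positivity) (by linarith)]
    nlinarith [mul_nonneg (sq_nonneg (n:ℝ)) (sub_nonneg.2 hnr), sq_nonneg (n:ℝ)]
  have a3 : 2 * (n - d : ℝ) / n ≤ 2 * (n - d) / (n - 1) := by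
    apply div_le_div_of_nonneg_left _ p1 <;> linarith
  have a4 : 2 - 2 / (q : ℝ) ≤ 2 * (n - d : ℝ) / n := by
    rw [le_div_iff₀ (by linarith)]
    have : (d : ℝ) ≤ n / q := by rw [le_div_iff₀ (by linarith)]; exact hd1
    have e : (2 - 2 / (q : ℝ)) * n = 2 * n - 2 * (n / q) := by ring
    rw [e]; linarith
  linarith

/-- The action of a permutation on unordered pairs. -/
def pairEquiv {n : ℕ} (π : Equiv.Perm (Fin n)) : Sym2 (Fin n) ≃ Sym2 (Fin n) where
  toFun := Sym2.map π
  invFun := Sym2.map π.symm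
  left_inv e := by simp [Sym2.map_map]
  right_inv e := by simp [Sym2.map_map]

/-- The ordering obtained by relabelling the vertices by `π`. -/
def relabel {n : ℕ} (π : Equiv.Perm (Fin n)) :
    {e : Sym2 (Fin n) // ¬ e.IsDiag} ≃ {e : Sym2 (Fin n) // ¬ e.IsDiag} :=
  (pairEquiv π).subtypeEquiv fun e => by
    induction e with
    | _ a b => simp [pairEquiv]

theorem Gt_relabel {n : ℕ} (π : Equiv.Perm (Fin n))
    (σ : Fin (n.choose 2) ≃ {e : Sym2 (Fin n) // ¬ e.IsDiag}) (t : ℕ) (e : Sym2 (Fin n)) :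
    e.map π ∈ Gt (σ.trans (relabel π)) t ↔ e ∈ Gt σ t := by
  have hinj : Function.Injective (Sym2.map π) := Sym2.map.injective π.injective
  have hval : ∀ s, ((relabel π (σ s) : {e : Sym2 (Fin n) // ¬ e.IsDiag}) : Sym2 (Fin n))
      = Sym2.map π (σ s) := fun s => rfl
  simp only [Gt, Set.mem_setOf_eq, Equiv.trans_apply, hval]
  constructor
  · rintro ⟨s, h1, h2⟩; exact ⟨s, h1, hinj h2⟩
  · rintro ⟨s, h1, h2⟩; exact ⟨s, h1, by rw [h2]⟩

theorem inc_relabel {n : ℕ} (π : Equiv.Perm (Fin n))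
    (σ : Fin (n.choose 2) ≃ {e : Sym2 (Fin n) // ¬ e.IsDiag}) (t : ℕ) (u : Fin n) :
    {e ∈ Gt (σ.trans (relabel π)) t | π u ∈ e} = Sym2.map π '' {e ∈ Gt σ t | u ∈ e} := by
  ext e
  obtain ⟨e, rfl⟩ := (pairEquiv π).surjective e
  change Sym2.map π e ∈ _ ↔ Sym2.map π e ∈ _
  rw [(Sym2.map.injective π.injective).mem_set_image]
  simp only [Set.mem_setOf_eq, Gt_relabel, Sym2.mem_map]
  simp

theorem degree_relabel {n : ℕ} (π : Equiv.Perm (Fin n))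
    (σ : Fin (n.choose 2) ≃ {e : Sym2 (Fin n) // ¬ e.IsDiag}) (t : ℕ) (u : Fin n) :
    degree (Gt (σ.trans (relabel π)) t) (π u) = degree (Gt σ t) u := by
  unfold degree
  rw [inc_relabel, Set.ncard_image_of_injective _ (Sym2.map.injective π.injective)]

theorem leaves_relabel {n : ℕ} (π : Equiv.Perm (Fin n))
    (σ : Fin (n.choose 2) ≃ {e : Sym2 (Fin n) // ¬ e.IsDiag}) (t : ℕ) :
    {u : Fin n | degree (Gt (σ.trans (relabel π)) t) u = 1}.ncard
      = {u : Fin n | degree (Gt σ t) u = 1}.ncard := by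
  rw [← Set.ncard_image_of_injective {u : Fin n | degree (Gt σ t) u = 1} π.injective]
  congr 1
  ext u
  obtain ⟨u, rfl⟩ := π.surjective u
  rw [π.injective.mem_set_image]
  simp [degree_relabel]

theorem Gt_not_diag {n : ℕ} (σ : Fin (n.choose 2) ≃ {e : Sym2 (Fin n) // ¬ e.IsDiag}) (t : ℕ)
    (e : Sym2 (Fin n)) (he : e ∈ Gt σ t) : ¬ e.IsDiag := by
  obtain ⟨s, _, rfl⟩ := he
  exact (σ s).2

theorem fibre_bound {n q : ℕ} (hn : 8 ≤ n) (hq : 1 ≤ q) (hqn : q ≤ n) (k : ℝ) (hk : 0 < k)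
    (x : Fin n → ℝ) (hx : Function.Injective x) (t : ℕ)
    (σ : Fin (n.choose 2) ≃ {e : Sym2 (Fin n) // ¬ e.IsDiag})
    (B : Set (Fin (n.choose 2) ≃ {e : Sym2 (Fin n) // ¬ e.IsDiag}))
    (hB : ∀ σ ∈ B, k ≤ (({u : Fin n | degree (Gt σ t) u = 1}).ncard : ℝ) ∧
          Reconstructible x (Gt σ t) Set.univ)
    (S : Finset (Equiv.Perm (Fin n))) (hS : ∀ π ∈ S, σ.trans (relabel π) ∈ B) :
    (S.card : ℝ) ≤ (n.factorial : ℝ) * (8 * q / k + 24 / n + 2 / q) := by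
  classical
  by_cases hS0 : S = ∅
  · subst hS0; simp; positivity
  obtain ⟨π₀, hπ₀⟩ := Finset.nonempty_iff_ne_empty.2 hS0
  have hk' := (hB _ (hS _ hπ₀)).1
  rw [leaves_relabel] at hk'
  obtain ⟨M, A, hM, hA0, hA1, hAF⟩ := free_count x hx (n / q) (Nat.div_le_self _ _)
  let L : Finset (Fin n) := Finset.univ.filter fun u => degree (Gt σ t) u = 1
  have hL : k ≤ (L.card : ℝ) := by
    refine hk'.trans (le_of_eq ?_)
    rw [← Set.ncard_coe_finset]
    simp [L]
  have hex : ∀ u ∈ L, ∃ v, {e ∈ Gt σ t | u ∈ e} = {s(u, v)} := by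
    intro u hu
    have h1 : degree (Gt σ t) u = 1 := by simpa [L] using hu
    obtain ⟨e, he⟩ := Set.ncard_eq_one.1 h1
    have hue : e ∈ {e ∈ Gt σ t | u ∈ e} := by rw [he]; rfl
    obtain ⟨v, hv⟩ := hue.2
    exact ⟨v, by rw [he, hv]⟩
  choose! N hN using hex
  have hNmem : ∀ u ∈ L, s(u, N u) ∈ Gt σ t := by
    intro u hu
    have : s(u, N u) ∈ {e ∈ Gt σ t | u ∈ e} := by rw [hN u hu]; rfl
    exact this.1
  have hNne : ∀ u ∈ L, N u ≠ u := by
    intro u hu h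
    exact Gt_not_diag σ t _ (hNmem u hu) (by simp [h])
  have hNN : ∀ u ∈ L, ∀ u' ∈ L, N u' = u → u' = N u := by
    intro u hu u' hu' h
    have h1 := hNmem u' hu'
    have h2 : s(u', N u') ∈ {e ∈ Gt σ t | u ∈ e} := ⟨h1, by simp [h]⟩
    rw [hN u hu, Set.mem_singleton_iff, h, Sym2.eq_iff] at h2
    rcases h2 with h2 | h2
    · rw [h2.2.symm, h2.1]
    · exact h2.1
  have main := second_moment' hn hq hqn k hk M A hM hA0 hA1
    (fun b hb => (hAF b b hb).1 rfl) L hL N hNne hNN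
  refine le_trans ?_ main
  refine Nat.cast_le.2 (Finset.card_le_card fun π hπ => ?_)
  simp only [Finset.mem_filter, Finset.mem_univ, true_and]
  intro u hu hmem
  refine not_free_of_rec (by omega) x hx _ (hB _ (hS _ hπ)).2 (π u) (π (N u)) ?_ (hAF _ _ hmem)
  intro e he hue
  have h2 : e ∈ {e ∈ Gt (σ.trans (relabel π)) t | π u ∈ e} := ⟨he, hue⟩
  rw [inc_relabel, hN u hu] at h2
  simpa using h2

/-- Orderings of the pairs. -/
abbrev Orders (n : ℕ) : Type := Fin (n.choose 2) ≃ {e : Sym2 (Fin n) // ¬ e.IsDiag}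

theorem count_bound {n : ℕ}
    (B : Set (Fin (n.choose 2) ≃ {e : Sym2 (Fin n) // ¬ e.IsDiag})) (c : ℝ) (hc : 0 ≤ c)
    (h : ∀ σ : Orders n, ∀ S : Finset (Equiv.Perm (Fin n)), (∀ π ∈ S, σ.trans (relabel π) ∈ B) →
      (S.card : ℝ) ≤ (n.factorial : ℝ) * c) :
    processMeasure n B ≤ ENNReal.ofReal c := by
  classical
  have hμ : processMeasure n B = (Fintype.card B : ENNReal) /
      Fintype.card (Fin (n.choose 2) ≃ {e : Sym2 (Fin n) // ¬ e.IsDiag}) := by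
    unfold processMeasure
    have hB : MeasurableSet B := MeasurableSpace.measurableSet_top
    exact PMF.toMeasure_uniformOfFintype_apply B hB
  rw [hμ]
  have pf : (0 : ℝ) < n.factorial := by exact_mod_cast n.factorial_pos
  have key : (Fintype.card B : ℝ) ≤ c * Fintype.card (Orders n) := by
    have h1 : ∀ π : Equiv.Perm (Fin n),
        ∑ σ : Orders n, (if σ.trans (relabel π) ∈ B then (1 : ℝ) else 0) = Fintype.card B := by
      intro π
      have : ∑ σ : Orders n, (if σ.trans (relabel π) ∈ B then (1 : ℝ) else 0)
          = ∑ σ : Orders n, (if σ ∈ B then (1 : ℝ) else 0) :=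
        Fintype.sum_equiv (Equiv.equivCongr (Equiv.refl _) (relabel π)) _ _ fun σ => rfl
      rw [this, Finset.sum_boole, Fintype.card_subtype]
    have h2 : ∑ σ : Orders n, ∑ π : Equiv.Perm (Fin n),
        (if σ.trans (relabel π) ∈ B then (1 : ℝ) else 0) = n.factorial * Fintype.card B := by
      rw [Finset.sum_comm, Finset.sum_congr rfl fun π _ => h1 π]
      simp [Fintype.card_perm]
    have h3 : ∑ σ : Orders n, ∑ π : Equiv.Perm (Fin n),
        (if σ.trans (relabel π) ∈ B then (1 : ℝ) else 0) ≤ ∑ σ : Orders n, (n.factorial : ℝ) * c := by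
      refine Finset.sum_le_sum fun σ _ => ?_
      rw [Finset.sum_boole]
      exact h σ _ fun π hπ => (Finset.mem_filter.1 hπ).2
    rw [h2, Finset.sum_const, nsmul_eq_mul, Finset.card_univ] at h3
    have h4 : (n.factorial : ℝ) * Fintype.card B ≤ n.factorial * (c * Fintype.card (Orders n)) := by
      linarith
    exact le_of_mul_le_mul_left h4 pf
  refine ENNReal.div_le_of_le_mul ?_
  have := ENNReal.ofReal_le_ofReal key
  rwa [ENNReal.ofReal_mul hc, ENNReal.ofReal_natCast, ENNReal.ofReal_natCast] at this

/-- If at a deterministic time of the random graph process there are at least `f n → ∞` indices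
of degree exactly one, then whp the whole point set is not reconstructible. -/
theorem statement13
    (f : ℕ → ℝ) (hf : Filter.Tendsto f Filter.atTop Filter.atTop)
    (x : (n : ℕ) → Fin n → ℝ) (hx : ∀ n, Function.Injective (x n))
    (t : ℕ → ℕ) (ht : ∀ n, t n ≤ n.choose 2) :
    Filter.Tendsto
      (fun (n : ℕ) => processMeasure n
        {σ | f n ≤ (({u : Fin n | degree (Gt σ (t n)) u = 1}).ncard : ℝ) ∧
          Reconstructible (x n) (Gt σ (t n)) Set.univ})
      Filter.atTop (nhds 0) := by
  rw [ENNReal.tendsto_nhds_zero]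
  intro ε hε
  by_cases htop : ε = ⊤
  · simp [htop]
  set r : ℝ := ε.toReal with hr
  have hr0 : 0 < r := ENNReal.toReal_pos hε.ne' htop
  obtain ⟨q, hq⟩ := exists_nat_gt (6 / r)
  have hq0 : (0 : ℝ) < q := lt_trans (by positivity) hq
  have hq1 : 1 ≤ q := by exact_mod_cast hq0
  have hq2 : 2 / (q : ℝ) ≤ r / 3 := by
    rw [div_lt_iff₀ hr0] at hq
    rw [div_le_div_iff₀ hq0 (by norm_num)]; linarith
  have hcast : Filter.Tendsto (fun n : ℕ => (n : ℝ)) Filter.atTop Filter.atTop :=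
    tendsto_natCast_atTop_atTop
  filter_upwards [Filter.eventually_ge_atTop 8, Filter.eventually_ge_atTop q,
    hf.eventually_ge_atTop (24 * q / r), hcast.eventually_ge_atTop (72 / r)] with n h8 hqn hfn hnr
  have hfpos : 0 < f n := lt_of_lt_of_le (by positivity) hfn
  have hnpos : (0 : ℝ) < n := by exact_mod_cast (show 0 < n by omega)
  have b1 : 8 * (q : ℝ) / f n ≤ r / 3 := by
    rw [div_le_iff₀ hr0] at hfn
    rw [div_le_div_iff₀ hfpos (by norm_num)]; linarith
  have b2 : 24 / (n : ℝ) ≤ r / 3 := by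
    rw [div_le_iff₀ hr0] at hnr
    rw [div_le_div_iff₀ hnpos (by norm_num)]; linarith
  refine (count_bound _ (8 * q / f n + 24 / n + 2 / q) (by positivity) fun σ S hS =>
    fibre_bound h8 hq1 hqn (f n) hfpos (x n) (hx n) (t n) σ _ (fun σ hσ => hσ) S hS).trans ?_
  rw [← ENNReal.ofReal_toReal htop]
  exact ENNReal.ofReal_le_ofReal (by linarith)
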